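/- Fix a composition α with largest part m. Let P = {i ≥ 1 : 𝔡_i 𝔱_i(α) ≠ 0} and Q = {i ≥ 1 : 𝔱_i 𝔡_i(α) ≠ 0}. For i ∈ Q let φ(i) = k + 1, where k is the largest part of α strictly less than i (k = 0 if none). Then m + 1 ∈ P, and φ is a bijection from Q onto P \ {m + 1}. -/

import Mathlib

namespace CompOps

/-- Subtract 1 from the rightmost part equal to `i`; `none` if no part equals `i`. -/
def removeAux (i : ℕ) : List ℕ → Option (List ℕ)
  | [] => none
  | x :: xs =>
    match removeAux i xs with
    | some ys => some (x :: ys)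
    | none => if x = i then some ((i - 1) :: xs) else none

/-- The box removing operator `𝔡ᵢ`, acting on weak compositions together with a
formal zero (`none`); `𝔡₀` is the identity. -/
def d : ℕ → Option (List ℕ) → Option (List ℕ)
  | 0, o => o
  | i + 1, o => o.bind (removeAux (i + 1))

/-- The appending operator `aᵢ`, appending a part `i` at the end. -/
def a (i : ℕ) : Option (List ℕ) → Option (List ℕ) :=
  Option.map (fun l => l ++ [i])

/-- `𝔡_I` for a finite set `I = {i₁ < ⋯ < i_k}`: the composite
`𝔡_{i₁}𝔡_{i₂}⋯𝔡_{i_k}`, where `𝔡_{i_k}` (the largest index) acts first. -/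
def dSet (I : Finset ℕ) : Option (List ℕ) → Option (List ℕ) :=
  (I.sort (· ≤ ·)).foldr (fun i f => d i ∘ f) id

/-- The jdt operator `𝔲ᵢ = aᵢ 𝔡_{[i-1]}` (with `𝔲₀` the identity). -/
def u : ℕ → Option (List ℕ) → Option (List ℕ)
  | 0 => id
  | i + 1 => a (i + 1) ∘ dSet (Finset.Icc 1 i)

/-- Add 1 to the leftmost part equal to `j`; `none` if no part equals `j`. -/
def addAux (j : ℕ) : List ℕ → Option (List ℕ)
  | [] => none
  | x :: xs => if x = j then some ((x + 1) :: xs) else (addAux j xs).map (x :: ·)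

/-- The box adding operator `𝔱ᵢ`: `𝔱₁` prepends a part 1, and for `i ≥ 2`, `𝔱ᵢ`
adds 1 to the leftmost part equal to `i - 1` (formal zero if there is none). -/
def t : ℕ → Option (List ℕ) → Option (List ℕ)
  | 0 => id
  | 1 => Option.map (fun l => 1 :: l)
  | i + 2 => fun o => o.bind (addAux (i + 1))

theorem removeAux_eq_none_iff (i : ℕ) (l : List ℕ) : removeAux i l = none ↔ i ∉ l := by
  induction l with
  | nil => simp [removeAux]
  | cons x xs ih =>
    cases h : removeAux i xs <;> simp_all [removeAux, eq_comm]

theorem pred_mem_of_removeAux_eq_some {i : ℕ} {l l' : List ℕ} (h : removeAux i l = some l') :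
    i - 1 ∈ l' := by
  induction l generalizing l' with
  | nil => simp [removeAux] at h
  | cons x xs ih =>
    cases hr : removeAux i xs with
    | none =>
      simp only [removeAux, hr, Option.ite_none_right_eq_some, Option.some.injEq] at h
      simp [← h.2]
    | some ys =>
      simp only [removeAux, hr, Option.some.injEq] at h
      simp [← h, ih hr]

theorem addAux_eq_none_iff (j : ℕ) (l : List ℕ) : addAux j l = none ↔ j ∉ l := by
  induction l with
  | nil => simp [addAux]
  | cons x xs ih => by_cases hx : x = j <;> simp_all [addAux, eq_comm]

theorem succ_mem_of_addAux_eq_some {j : ℕ} {l l' : List ℕ} (h : addAux j l = some l') :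
    j + 1 ∈ l' := by
  induction l generalizing l' with
  | nil => simp [addAux] at h
  | cons x xs ih =>
    by_cases hx : x = j
    · simp only [addAux, hx, if_true, Option.some.injEq] at h
      simp [← h]
    · simp only [addAux, hx, if_false, Option.map_eq_some_iff] at h
      obtain ⟨ys, hys, rfl⟩ := h
      simp [ih hys]

/-- `𝔡ᵢ₊₁ 𝔱ᵢ₊₁` does not annihilate `l` iff `i = 0` or `i` is a part of `l`. -/
theorem d_t_succ_ne_none_iff (i : ℕ) (l : List ℕ) :
    d (i + 1) (t (i + 1) (some l)) ≠ none ↔ i = 0 ∨ i ∈ l := by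
  cases i with
  | zero => simp [d, t, removeAux_eq_none_iff]
  | succ n =>
    cases h : addAux (n + 1) l with
    | none => simp [d, t, h, (addAux_eq_none_iff _ _).1 h]
    | some l' =>
      have hl : n + 1 ∈ l := by
        by_contra hc
        simp [(addAux_eq_none_iff _ _).2 hc] at h
      simp [d, t, h, removeAux_eq_none_iff, succ_mem_of_addAux_eq_some h, hl]

/-- `𝔱ᵢ₊₁ 𝔡ᵢ₊₁` does not annihilate `l` iff `i + 1` is a part of `l`. -/
theorem t_d_succ_ne_none_iff (i : ℕ) (l : List ℕ) :
    t (i + 1) (d (i + 1) (some l)) ≠ none ↔ i + 1 ∈ l := by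
  cases i with
  | zero => simp [d, t, removeAux_eq_none_iff]
  | succ n =>
    cases h : removeAux (n + 1 + 1) l with
    | none => simp [d, t, h, (removeAux_eq_none_iff _ _).1 h]
    | some l' =>
      have hl : n + 1 + 1 ∈ l := by
        by_contra hc
        simp [(removeAux_eq_none_iff _ _).2 hc] at h
      have hp : n + 1 ∈ l' := pred_mem_of_removeAux_eq_some h
      simp [d, t, h, addAux_eq_none_iff, hp, hl]

theorem le_foldr_max {l : List ℕ} {x : ℕ} (h : x ∈ l) : x ≤ l.foldr max 0 := by
  induction l with
  | nil => simp at h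
  | cons y ys ih => grind

theorem foldr_max_eq_zero_or_mem (l : List ℕ) : l.foldr max 0 = 0 ∨ l.foldr max 0 ∈ l := by
  induction l with
  | nil => simp
  | cons y ys ih => grind

/-- With `P = {i ≥ 1 : 𝔡ᵢ 𝔱ᵢ(α) ≠ 0}`, `Q = {i ≥ 1 : 𝔱ᵢ 𝔡ᵢ(α) ≠ 0}` and
`φ(i) = k + 1`, `k` the largest part of `α` strictly less than `i` (`k = 0` if none),
for a composition `α` with largest part `m`: `m + 1 ∈ P` and `φ` is a bijection from
`Q` onto `P \ {m + 1}`. -/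
theorem PhiQ_eq_P_minus (α : List ℕ) (hα : ∀ x ∈ α, 0 < x) (hne : α ≠ []) :
    let m := α.foldr max 0
    let P : Set ℕ := {i | 1 ≤ i ∧ d i (t i (some α)) ≠ none}
    let Q : Set ℕ := {i | 1 ≤ i ∧ t i (d i (some α)) ≠ none}
    let φ : ℕ → ℕ := fun i => (α.filter (fun p => p < i)).foldr max 0 + 1
    m + 1 ∈ P ∧ Set.BijOn φ Q (P \ {m + 1}) := by
  intro m P Q φ
  have hP (i : ℕ) : i + 1 ∈ P ↔ i = 0 ∨ i ∈ α := by
    simpa [P] using d_t_succ_ne_none_iff i α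
  have hQ (i : ℕ) : i ∈ Q ↔ i ∈ α := by
    cases i with
    | zero => simpa [Q] using fun h => (hα 0 h).false
    | succ n => simpa [Q] using t_d_succ_ne_none_iff n α
  have hle (x : ℕ) (hx : x ∈ α) : x ≤ m := le_foldr_max hx
  have hm : m = 0 ∨ m ∈ α := foldr_max_eq_zero_or_mem α
  have hm_mem : m ∈ α := by
    obtain ⟨x, hx⟩ := List.exists_mem_of_ne_nil α hne
    have := hα x hx
    have := hle x hx
    exact hm.resolve_left (by omega)
  have hφ_ge (i x : ℕ) (hx : x ∈ α) (hxi : x < i) : x + 1 ≤ φ i :=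
    Nat.succ_le_succ (le_foldr_max (by simp [hx, hxi]))
  have hφ (i : ℕ) : ∃ k, φ i = k + 1 ∧ (k = 0 ∨ k ∈ α ∧ k < i) :=
    ⟨_, rfl, by simpa using foldr_max_eq_zero_or_mem (α.filter (fun p => p < i))⟩
  have hφ_le (i : ℕ) (hi : i ∈ α) : φ i ≤ i := by
    obtain ⟨k, hk, h⟩ := hφ i
    have := hα i hi
    omega
  refine ⟨(hP m).2 hm, ?_, ?_, ?_⟩
  · intro i hi
    rw [hQ] at hi
    have h1 := hφ_le i hi
    have h2 := hle i hi
    obtain ⟨k, hk, h⟩ := hφ i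
    refine ⟨?_, ?_⟩
    · rw [hk, hP]
      exact h.imp_right And.left
    · rw [Set.mem_singleton_iff]
      omega
  · intro i hi j hj hij
    rw [hQ] at hi hj
    have h1 := hφ_le i hi
    have h2 := hφ_le j hj
    rcases lt_trichotomy i j with h | h | h
    · have := hφ_ge j i hi h
      omega
    · exact h
    · have := hφ_ge i j hj h
      omega
  · rintro p ⟨hp, hpm⟩
    obtain ⟨k, rfl⟩ : ∃ k, p = k + 1 := Nat.exists_eq_add_of_le' hp.1
    rw [hP] at hp
    have hkm : k < m := by
      have hk_ne : k ≠ m := fun h => hpm (by simp [h])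
      rcases hp with rfl | hk
      · exact hα m hm_mem
      · exact lt_of_le_of_ne (hle k hk) hk_ne
    have hex : ∃ i, i ∈ α ∧ k < i := ⟨m, hm_mem, hkm⟩
    obtain ⟨hi, hki⟩ := Nat.find_spec hex
    have hmin (x : ℕ) (hx : x ∈ α) (hlt : x < Nat.find hex) : x ≤ k :=
      not_lt.1 fun h => Nat.find_min hex hlt ⟨hx, h⟩
    refine ⟨Nat.find hex, (hQ _).2 hi, ?_⟩
    obtain ⟨k', hk', h⟩ := hφ (Nat.find hex)
    have hk'k : k' ≤ k := by
      rcases h with rfl | h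
      · exact Nat.zero_le k
      · exact hmin k' h.1 h.2
    rcases hp with rfl | hk
    · omega
    · have := hφ_ge _ k hk hki
      omega

end CompOps
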